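/- Let ψ be a branching mechanism with parameters α > 0, β ≥ 0 and Lévy measure ν, assume ψ(λ) → ∞ as λ → ∞, and let λ* > 0 be the unique positive root of ψ. Then ∫_{λ*+1}^∞ (∫_{λ*}^ξ ψ(u) du)^{-1/2} dξ < ∞ if and only if ∫_1^∞ (∫_0^ξ (ψ(u) + αu) du)^{-1/2} dξ < ∞. -/

import Mathlib

open MeasureTheory Real Set Filter

lemma exp_neg_mul_sub_one_add_nonneg (l x : ℝ) : 0 ≤ Real.exp (-l * x) - 1 + l * x := by
  have := Real.add_one_le_exp (-l * x)
  linarith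

lemma exp_neg_mul_sub_one_add_le {l x : ℝ} (hl : 0 ≤ l) (hx : 0 ≤ x) :
    Real.exp (-l * x) - 1 + l * x ≤ (l + l ^ 2) * min x (x ^ 2) := by
  have hy : 0 ≤ l * x := mul_nonneg hl hx
  have hlin : Real.exp (-l * x) - 1 + l * x ≤ l * x := by
    have : Real.exp (-l * x) ≤ 1 := Real.exp_le_one_iff.2 (by linarith)
    linarith
  have hsq : Real.exp (-l * x) - 1 + l * x ≤ (l * x) ^ 2 := by
    rcases le_total (l * x) 1 with h | h
    · have := (abs_le.1 (Real.abs_exp_sub_one_sub_id_le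
        (show |(-l * x)| ≤ 1 by rw [neg_mul, abs_neg, abs_of_nonneg hy]; exact h))).2
      linarith [show (-l * x) ^ 2 = (l * x) ^ 2 by ring]
    · nlinarith
  rcases min_choice x (x ^ 2) with h | h <;> rw [h]
  · nlinarith [mul_nonneg (sq_nonneg l) hx]
  · nlinarith [mul_nonneg hl (sq_nonneg x)]

lemma exp_neg_mul_sub_one_add_mul_le {a b : ℝ} (ha : 0 ≤ a) (hab : a ≤ b) (x : ℝ) :
    (Real.exp (-a * x) - 1 + a * x) * b ≤ (Real.exp (-b * x) - 1 + b * x) * a := by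
  rcases (ha.trans hab).eq_or_lt with hb | hb
  · have : a = b := le_antisymm hab (hb ▸ ha)
    rw [this]
  have h := convexOn_exp.2 (mem_univ (-b * x)) (mem_univ 0) (div_nonneg ha hb.le)
    (sub_nonneg.2 ((div_le_one hb).2 hab)) (add_sub_cancel _ _)
  simp only [smul_eq_mul, mul_zero, add_zero, Real.exp_zero, mul_one] at h
  have h1 : a / b * (-b * x) = -a * x := by field_simp
  rw [h1] at h
  have h2 := mul_le_mul_of_nonneg_right h hb.le
  have h3 : (a / b * Real.exp (-b * x) + (1 - a / b)) * b = a * Real.exp (-b * x) + (b - a) := by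
    field_simp
  rw [h3] at h2
  linarith

section Levy

variable {ν : Measure ℝ}

lemma ae_pos_of_measure_Iic_eq_zero (hν0 : ν (Set.Iic 0) = 0) : ∀ᵐ x ∂ν, 0 < x := by
  rw [ae_iff]
  simpa [Set.Iic] using hν0

lemma integrable_exp_neg_mul_sub_one_add (hν0 : ν (Set.Iic 0) = 0)
    (hν : ∫⁻ x, ENNReal.ofReal (min x (x ^ 2)) ∂ν ≠ ⊤) {l : ℝ} (hl : 0 ≤ l) :
    Integrable (fun x => Real.exp (-l * x) - 1 + l * x) ν := by
  have hpos := ae_pos_of_measure_Iic_eq_zero hν0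
  have hmin : Integrable (fun x : ℝ => min x (x ^ 2)) ν := by
    refine (lintegral_ofReal_ne_top_iff_integrable ?_ ?_).1 hν
    · exact (by fun_prop : Continuous fun x : ℝ => min x (x ^ 2)).aestronglyMeasurable
    · filter_upwards [hpos] with x hx
      exact le_min hx.le (sq_nonneg x)
  refine (hmin.const_mul (l + l ^ 2)).mono'
    (by fun_prop : Continuous _).aestronglyMeasurable ?_
  filter_upwards [hpos] with x hx
  rw [Real.norm_of_nonneg (exp_neg_mul_sub_one_add_nonneg l x)]
  exact exp_neg_mul_sub_one_add_le hl hx.le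

/-- If the shifted mechanism vanishes at one positive point, then it vanishes everywhere. -/
lemma levyKhintchine_eq_zero_of_eq_zero (hν0 : ν (Set.Iic 0) = 0)
    (hν : ∫⁻ x, ENNReal.ofReal (min x (x ^ 2)) ∂ν ≠ ⊤) {β : ℝ} (hβ : 0 ≤ β) {u : ℝ}
    (hu : 0 < u) (h : β * u ^ 2 + ∫ x, (Real.exp (-u * x) - 1 + u * x) ∂ν = 0) (l : ℝ) :
    β * l ^ 2 + ∫ x, (Real.exp (-l * x) - 1 + l * x) ∂ν = 0 := by
  have hI : 0 ≤ ∫ x, (Real.exp (-u * x) - 1 + u * x) ∂ν :=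
    integral_nonneg fun x => exp_neg_mul_sub_one_add_nonneg u x
  have hb : 0 ≤ β * u ^ 2 := by positivity
  have hβ0 : β = 0 := by
    have : β * u ^ 2 = 0 := by linarith
    exact (mul_eq_zero.1 this).resolve_right (by positivity)
  have hI0 : ∫ x, (Real.exp (-u * x) - 1 + u * x) ∂ν = 0 := by linarith
  rw [integral_eq_zero_iff_of_nonneg (fun x => exp_neg_mul_sub_one_add_nonneg u x)
    (integrable_exp_neg_mul_sub_one_add hν0 hν hu.le)] at hI0
  have hF : ∀ᵐ _x ∂ν, False := by
    filter_upwards [hI0, ae_pos_of_measure_Iic_eq_zero hν0] with x hx hx0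
    have hlt := Real.add_one_lt_exp (x := -u * x) (by nlinarith [mul_pos hu hx0])
    simp only [Pi.zero_apply] at hx
    linarith
  have hν' : ν = 0 := by
    simpa [ae_iff] using hF
  simp [hβ0, hν']

end Levy

section Comparison

variable {φ : ℝ → ℝ}

lemma monotoneOn_of_mul_le_mul (hpos : ∀ u, 0 < u → 0 < φ u)
    (hscale : ∀ a b, 0 ≤ a → a ≤ b → φ a * b ≤ φ b * a) : MonotoneOn φ (Set.Ici 0) := by
  intro a ha b _ hab
  rcases (le_trans ha hab).eq_or_lt with hb | hb
  · have : a = b := le_antisymm hab (hb ▸ ha)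
    rw [this]
  · have h1 := hscale a b ha hab
    have h2 : φ b * a ≤ φ b * b := mul_le_mul_of_nonneg_left hab (hpos b hb).le
    exact le_of_mul_le_mul_right (h1.trans h2) hb

lemma ofReal_inv_sqrt_le {s t c : ℝ} (hc : 0 < c) (ht : 0 < t) (h : c * t ≤ s) :
    ENNReal.ofReal (Real.sqrt s)⁻¹ ≤
      ENNReal.ofReal (Real.sqrt c)⁻¹ * ENNReal.ofReal (Real.sqrt t)⁻¹ := by
  rw [← ENNReal.ofReal_mul (by positivity), ← mul_inv, ← Real.sqrt_mul hc.le]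
  refine ENNReal.ofReal_le_ofReal (inv_anti₀ (Real.sqrt_pos.2 (by positivity)) ?_)
  exact Real.sqrt_le_sqrt h

/-- Subtracting a linear term from a star-shaped function does not affect the finiteness of
`∫^∞ (∫^ξ φ)^{-1/2} dξ`, as long as the difference is eventually positive. -/
lemma lintegral_inv_sqrt_sub_linear_ne_top_iff (hpos : ∀ u, 0 < u → 0 < φ u)
    (hscale : ∀ a b, 0 ≤ a → a ≤ b → φ a * b ≤ φ b * a)
    {α r : ℝ} (hα : 0 < α) (hr : 0 < r) (hsub : ∀ u, r < u → 0 < φ u - α * u) :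
    (∫⁻ ξ in Set.Ici (r + 1),
        ENNReal.ofReal ((Real.sqrt (∫ u in r..ξ, φ u - α * u))⁻¹) ≠ ⊤) ↔
    (∫⁻ ξ in Set.Ici (1 : ℝ),
        ENNReal.ofReal ((Real.sqrt (∫ u in (0 : ℝ)..ξ, φ u))⁻¹) ≠ ⊤) := by
  have hint : ∀ a b, 0 ≤ a → 0 ≤ b → IntervalIntegrable φ volume a b := fun a b ha hb =>
    ((monotoneOn_of_mul_le_mul hpos hscale).mono fun x hx =>
      (le_min ha hb).trans hx.1).intervalIntegrable
  have hintsub : ∀ a b, 0 ≤ a → 0 ≤ b →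
      IntervalIntegrable (fun u => φ u - α * u) volume a b := fun a b ha hb =>
    (hint a b ha hb).sub ((continuous_const_mul α).intervalIntegrable a b)
  have hBpos : ∀ a b, 0 ≤ a → a < b → 0 < ∫ u in a..b, φ u := fun a b ha hab =>
    intervalIntegral.intervalIntegral_pos_of_pos_on (hint a b ha (ha.trans hab.le))
      (fun x hx => hpos x (ha.trans_lt hx.1)) hab
  have hApos : ∀ ξ, r < ξ → 0 < ∫ u in r..ξ, φ u - α * u := fun ξ hξ =>
    intervalIntegral.intervalIntegral_pos_of_pos_on (hintsub r ξ hr.le (hr.trans hξ).le)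
      (fun x hx => hsub x hx.1) hξ
  constructor
  · intro h
    have hsplit : Set.Ici (1 : ℝ) ⊆ Set.Icc 1 (r + 1) ∪ Set.Ici (r + 1) := fun x hx =>
      (le_total x (r + 1)).imp (fun h => ⟨hx, h⟩) id
    refine ne_top_of_le_ne_top (ENNReal.add_ne_top.2 ⟨?_, ?_⟩)
      ((lintegral_mono_set hsplit).trans (lintegral_union_le _ _ _))
    · refine ne_top_of_le_ne_top ?_ (setLIntegral_mono' measurableSet_Icc
        (g := fun _ => ENNReal.ofReal (Real.sqrt (∫ u in (0 : ℝ)..1, φ u))⁻¹) ?_)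
      · rw [setLIntegral_const]
        exact ENNReal.mul_ne_top ENNReal.ofReal_ne_top (by simp)
      · intro ξ hξ
        have h1 := hBpos 0 1 le_rfl one_pos
        have h2 : 0 ≤ ∫ u in (1 : ℝ)..ξ, φ u := intervalIntegral.integral_nonneg hξ.1
          fun u hu => (hpos u (one_pos.trans_le hu.1)).le
        have h3 := intervalIntegral.integral_add_adjacent_intervals
          (hint 0 1 le_rfl zero_le_one) (hint 1 ξ zero_le_one (zero_le_one.trans hξ.1))
        simpa using ofReal_inv_sqrt_le one_pos h1
          (show 1 * (∫ u in (0 : ℝ)..1, φ u) ≤ ∫ u in (0 : ℝ)..ξ, φ u by linarith)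
    · refine ne_top_of_le_ne_top h (setLIntegral_mono' measurableSet_Ici ?_)
      intro ξ hξ
      have hrξ : r < ξ := (lt_add_one r).trans_le hξ
      have h2 := hBpos 0 r le_rfl hr
      have h3 := intervalIntegral.integral_add_adjacent_intervals
        (hint 0 r le_rfl hr.le) (hint r ξ hr.le (hr.trans hrξ).le)
      have h4 : (∫ u in r..ξ, φ u - α * u) ≤ ∫ u in r..ξ, φ u :=
        intervalIntegral.integral_mono_on hrξ.le (hintsub r ξ hr.le (hr.trans hrξ).le)
          (hint r ξ hr.le (hr.trans hrξ).le) fun u hu => by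
            nlinarith [mul_pos hα (hr.trans_le hu.1)]
      simpa using ofReal_inv_sqrt_le one_pos (hApos ξ hrξ)
        (show 1 * (∫ u in r..ξ, φ u - α * u) ≤ ∫ u in (0 : ℝ)..ξ, φ u by linarith)
  · intro h
    have hr1 : 0 < r + 1 := by linarith
    have hA1 := hApos (r + 1) (lt_add_one r)
    have hB1 := hBpos 0 (r + 1) le_rfl hr1
    have hφ1 := hpos (r + 1) hr1
    have hψ1 := hsub (r + 1) (lt_add_one r)
    obtain ⟨c, hc, hcA, hcφ⟩ : ∃ c, 0 < c ∧
        c * (∫ u in (0 : ℝ)..(r + 1), φ u) ≤ (∫ u in r..(r + 1), φ u - α * u) ∧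
        c * φ (r + 1) ≤ φ (r + 1) - α * (r + 1) := by
      refine ⟨min _ _, lt_min (div_pos hA1 hB1) (div_pos hψ1 hφ1), ?_, ?_⟩
      · exact (le_div_iff₀ hB1).1 (min_le_left _ _)
      · exact (le_div_iff₀ hφ1).1 (min_le_right _ _)
    have hcu : ∀ u, r + 1 ≤ u → c * φ u ≤ φ u - α * u := by
      intro u hu
      have h1 := hscale (r + 1) u hr1.le hu
      have hφu := hpos u (hr1.trans_le hu)
      refine le_of_mul_le_mul_right ?_ hφ1
      nlinarith [mul_le_mul_of_nonneg_left hcφ hφu.le, mul_le_mul_of_nonneg_left h1 hα.le]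
    refine ne_top_of_le_ne_top (ENNReal.mul_ne_top ENNReal.ofReal_ne_top h)
      (b := ENNReal.ofReal (Real.sqrt c)⁻¹ * _) ?_
    rw [← lintegral_const_mul' _ _ ENNReal.ofReal_ne_top]
    refine (setLIntegral_mono' measurableSet_Ici ?_).trans
      (lintegral_mono_set (Set.Ici_subset_Ici.2 (by linarith : (1 : ℝ) ≤ r + 1)))
    intro ξ hξ
    have hξ0 : 0 < ξ := hr1.trans_le hξ
    refine ofReal_inv_sqrt_le hc (hBpos 0 ξ le_rfl hξ0) ?_
    rw [← intervalIntegral.integral_add_adjacent_intervals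
        (hint 0 (r + 1) le_rfl hr1.le) (hint (r + 1) ξ hr1.le hξ0.le),
      ← intervalIntegral.integral_add_adjacent_intervals
        (hintsub r (r + 1) hr.le hr1.le) (hintsub (r + 1) ξ hr1.le hξ0.le), mul_add]
    refine add_le_add hcA ?_
    rw [← intervalIntegral.integral_const_mul]
    exact intervalIntegral.integral_mono_on hξ ((hint _ _ hr1.le hξ0.le).const_mul c)
      (hintsub _ _ hr1.le hξ0.le) fun u hu => hcu u hu.1

end Comparison

/-- For a branching mechanism `ψ` with `ψ(λ) → ∞` and unique positive
root `λ*`, condition (A3) `∫^∞ (∫_{λ*}^ξ ψ(u) du)^{-1/2} dξ < ∞` holds if and only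
if `∫^∞ (∫_0^ξ (ψ(u) + αu) du)^{-1/2} dξ < ∞`. -/
theorem A3_iff_shifted_form
    (α β : ℝ) (hα : 0 < α) (hβ : 0 ≤ β)
    (ν : Measure ℝ) (hν0 : ν (Set.Iic 0) = 0)
    (hν : ∫⁻ x, ENNReal.ofReal (min x (x ^ 2)) ∂ν ≠ ⊤)
    (ψ : ℝ → ℝ)
    (hψ : ∀ l : ℝ, ψ l = -α * l + β * l ^ 2 + ∫ x, (Real.exp (-l * x) - 1 + l * x) ∂ν)
    (hψ_top : Tendsto ψ atTop atTop)
    (lstar : ℝ) (hlstar_pos : 0 < lstar) (hlstar_root : ψ lstar = 0)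
    (hlstar_unique : ∀ l : ℝ, lstar < l → 0 < ψ l) :
    (∫⁻ ξ in Set.Ici (lstar + 1),
        ENNReal.ofReal ((Real.sqrt (∫ u in lstar..ξ, ψ u))⁻¹) ≠ ⊤) ↔
    (∫⁻ ξ in Set.Ici (1 : ℝ),
        ENNReal.ofReal ((Real.sqrt (∫ u in (0 : ℝ)..ξ, ψ u + α * u))⁻¹) ≠ ⊤) := by
  have hφ : ∀ u, ψ u + α * u = β * u ^ 2 + ∫ x, (Real.exp (-u * x) - 1 + u * x) ∂ν :=
    fun u => by rw [hψ]; ring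
  have hpos : ∀ u, 0 < u → 0 < ψ u + α * u := by
    intro u hu
    have hnonneg : 0 ≤ ψ u + α * u := by
      rw [hφ]
      exact add_nonneg (by positivity)
        (integral_nonneg fun x => exp_neg_mul_sub_one_add_nonneg u x)
    refine hnonneg.lt_of_ne fun h0 => ?_
    have h := levyKhintchine_eq_zero_of_eq_zero hν0 hν hβ hu ((hφ u).symm.trans h0.symm) lstar
    rw [← hφ, hlstar_root, zero_add] at h
    exact (mul_pos hα hlstar_pos).ne' h
  have hscale : ∀ a b, 0 ≤ a → a ≤ b → (ψ a + α * a) * b ≤ (ψ b + α * b) * a := by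
    intro a b ha hab
    rw [hφ, hφ, add_mul, add_mul, ← integral_mul_const, ← integral_mul_const]
    refine add_le_add ?_ (integral_mono
      ((integrable_exp_neg_mul_sub_one_add hν0 hν ha).mul_const b)
      ((integrable_exp_neg_mul_sub_one_add hν0 hν (ha.trans hab)).mul_const a)
      fun x => exp_neg_mul_sub_one_add_mul_le ha hab x)
    nlinarith [mul_nonneg (mul_nonneg hβ (mul_nonneg ha (ha.trans hab))) (sub_nonneg.2 hab)]
  have h := lintegral_inv_sqrt_sub_linear_ne_top_iff (φ := fun u => ψ u + α * u) hpos hscale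
    hα hlstar_pos (fun u hu => by simpa using hlstar_unique u hu)
  simpa only [add_sub_cancel_right] using h
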